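/- arXiv:1511.00152 — 2 statements merged into one kernel-verified Lean document; each statement's English description precedes it below -/
import Mathlib

section
/- Let 1 ≤ m ≤ p, let n_k ≥ 1, and let R₁,…,R_{n_k} ∈ ℝ^{p×m} be independent sampling matrices (each consisting of m distinct canonical basis vectors of ℝ^p chosen uniformly at random without replacement). Define H_k = (p/m)·(1/n_k)·Σ_{i=1}^{n_k} R_i R_iᵀ. Then for all t ≥ 0: P( ‖H_k − I_p‖₂ ≤ t ) ≥ 1 − δ₃, where δ₃ = p·exp( −(n_k t²/2) / ( (p/m − 1) + (p/m + 1)·t/3 ) ). -/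
open Matrix Finset

/-- Probability of event `A` under the uniform distribution on the finite type `Ω`. -/
noncomputable def probOf {Ω : Type*} [Fintype Ω] (A : Set Ω) : ℝ :=
  (A.ncard : ℝ) / Fintype.card Ω

/-- Expectation of `f` under the uniform distribution on the finite type `Ω`. -/
noncomputable def expec {Ω E : Type*} [Fintype Ω] [AddCommMonoid E] [Module ℝ E]
    (f : Ω → E) : E :=
  (Fintype.card Ω : ℝ)⁻¹ • ∑ ω, f ω

/-- Euclidean norm of a vector. -/
noncomputable def l2norm {ι : Type*} [Fintype ι] (v : ι → ℝ) : ℝ :=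
  Real.sqrt (∑ i, v i ^ 2)

/-- Random sign vector `ε ∈ {±1}^p` built from boolean coin flips. -/
def signVec {p : ℕ} (ω : Fin p → Bool) : Fin p → ℝ := fun i => if ω i then 1 else -1

/-- The diagonal random sign matrix `D = diag(ε)`. -/
noncomputable def signMatrix {p : ℕ} (ω : Fin p → Bool) : Matrix (Fin p) (Fin p) ℝ :=
  Matrix.diagonal (signVec ω)

/-- Sampling matrix `R ∈ ℝ^{p×m}` whose `j`-th column is the canonical basis vector `e_{σ j}`;
a uniformly random `σ : Fin m ↪ Fin p` models choosing `m` distinct canonical basis vectors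
uniformly at random without replacement. -/
noncomputable def sampMatrix {p m : ℕ} (σ : Fin m ↪ Fin p) : Matrix (Fin p) (Fin m) ℝ :=
  Matrix.of fun i j => if σ j = i then 1 else 0

/-- Spectral norm (ℓ²→ℓ² operator norm) of a square matrix. -/
noncomputable def specNorm {p : ℕ} (A : Matrix (Fin p) (Fin p) ℝ) : ℝ :=
  ‖LinearMap.toContinuousLinearMap (Matrix.toEuclideanLin A)‖

/-- `diag(A)`: the matrix obtained by zeroing all off-diagonal entries of `A`. -/
noncomputable def diagPart {p : ℕ} (A : Matrix (Fin p) (Fin p) ℝ) : Matrix (Fin p) (Fin p) ℝ :=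
  Matrix.diagonal A.diag

theorem F_U (q l th x : ℝ) (hq0 : 0 ≤ q) (hq1 : q ≤ 1) (hl : 1.098 ≤ l) (ht0 : 0 ≤ th) (ht1 : th ≤ 1)
   (hx : 2*l*(4-2*q)/3 ≤ x) :
   0.01*(1-q)*(x+1) ≤ 2*l*(x*(q-q^2/3) - (1-q)^2*((1+th)/2)/3) + x*(1-2*q) - (th^2+th)*(1-q) + th*(1-th)*q := by
  have h1 : 0 ≤ th*(1-th)*q := mul_nonneg (mul_nonneg ht0 (by linarith)) hq0
  have h2 : (th^2+th)*(1-q) ≤ 2*(1-q) := mul_le_mul_of_nonneg_right (by nlinarith) (by linarith)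
  have h3 : 2*l*((1-q)^2*((1+th)/2)/3) ≤ 2*l*((1-q)^2/3) := by
    apply mul_le_mul_of_nonneg_left _ (by linarith)
    nlinarith [sq_nonneg (1-q)]
  have hqq : 0 ≤ q*(1-q) := mul_nonneg hq0 (by linarith)
  have hc : 0 ≤ 2*l*(q-q^2/3) + (1-2*q) - 0.01*(1-q) := by
    have : 2*1.098*(q-q^2/3) ≤ 2*l*(q-q^2/3) := by
      apply mul_le_mul_of_nonneg_right (by linarith); nlinarith
    nlinarith
  have h4 := mul_le_mul_of_nonneg_left hx hc
  -- remaining: polynomial in q,l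
  have key : 0 ≤ (2*l*(q-q^2/3) + (1-2*q) - 0.01*(1-q)) * (2*l*(4-2*q)/3) - 2*l*((1-q)^2/3) - 2*(1-q) - 0.01*(1-q) := by
    obtain ⟨d, hd⟩ : ∃ d, l = 1.098 + d := ⟨l-1.098, by ring⟩
    have hd0 : 0 ≤ d := by linarith
    subst hd
    have e : (2*(1.098+d)*(q-q^2/3) + (1-2*q) - 0.01*(1-q)) * (2*(1.098+d)*(4-2*q)/3) - 2*(1.098+d)*((1-q)^2/3) - 2*(1-q) - 0.01*(1-q) =
      d^2 * (4*(q-q^2/3)*(4-2*q)/3) + d * (2*(4-2*q)/3 * (4*1.098*(q-q^2/3) + (1-2*q) - 0.01*(1-q)) - 2*((1-q)^2/3)) + ((2*1.098*(q-q^2/3) + (1-2*q) - 0.01*(1-q)) * (2*1.098*(4-2*q)/3) - 2*1.098*((1-q)^2/3) - 2*(1-q) - 0.01*(1-q)) := by ring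
    rw [e]
    have a1 : 0 ≤ 4*(q-q^2/3)*(4-2*q)/3 := by
      have : 0 ≤ q - q^2/3 := by nlinarith
      have : 0 ≤ 4 - 2*q := by linarith
      positivity
    have a2 : 0 ≤ 2*(4-2*q)/3 * (4*1.098*(q-q^2/3) + (1-2*q) - 0.01*(1-q)) - 2*((1-q)^2/3) := by
      nlinarith [mul_nonneg hqq hq0, mul_nonneg hqq (sub_nonneg.2 hq1)]
    have a3 : 0 ≤ ((2*1.098*(q-q^2/3) + (1-2*q) - 0.01*(1-q)) * (2*1.098*(4-2*q)/3) - 2*1.098*((1-q)^2/3) - 2*(1-q) - 0.01*(1-q)) := by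
      nlinarith [mul_nonneg hqq hq0, mul_nonneg hqq (sub_nonneg.2 hq1)]
    positivity
  linarith

theorem F_L (u l th x : ℝ) (hq0 : 0 ≤ u) (hq1 : u ≤ 1) (hl : 1.098 ≤ l) (ht0 : 0 ≤ th) (ht1 : th ≤ 1)
   (hx : 2*l*(4-2*u)/3 ≤ x) (hx2 : 2*l*(1+4*u)/3 ≤ x) (h : 3 ≤ 2*l*(1+u) ∨ 1/3 ≤ u) :
   0.01*u*(x+1) ≤ 2*l*(x*((1+u-u^2)/3) - u^2*((1+th)/2)/3) + x*(2*u-1) - (th^2+th)*u + th*(1-th)*(1-u) := by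
  have h1 : 0 ≤ th*(1-th)*(1-u) := mul_nonneg (mul_nonneg ht0 (by linarith)) (by linarith)
  have h2 : (th^2+th)*u ≤ 2*u := mul_le_mul_of_nonneg_right (by nlinarith) (by linarith)
  have h3 : 2*l*(u^2*((1+th)/2)/3) ≤ 2*l*(u^2/3) := by
    apply mul_le_mul_of_nonneg_left _ (by linarith)
    nlinarith [sq_nonneg u]
  have hqq : 0 ≤ u*(1-u) := mul_nonneg hq0 (by linarith)
  have h5 : 2.196 ≤ x := by
    rcases le_total u (1/2) with h | h <;> nlinarith
  -- coefficient lower bound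
  have hc : 0.95*u + 2*l*(u^2/3) * 0.46 ≤ 2*l*((1+u-u^2)/3) + (2*u-1) - 0.01*u := by
    rcases h with h | h
    · have g1 : 0 ≤ l * (u*(1-u)) := mul_nonneg (by linarith) hqq
      have g2 := mul_le_mul_of_nonneg_right h (by linarith : 0 ≤ 1 - 0.73*u)
      nlinarith
    · have g1 : 0 ≤ (l - 1.098) * (1 + u - 1.46*u^2) := mul_nonneg (by linarith) (by nlinarith)
      nlinarith
  have h4 := mul_le_mul_of_nonneg_right hc (by linarith : 0 ≤ x)
  have h6 : 0 ≤ 2*l*(u^2/3) := by positivity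
  nlinarith
theorem fin_ineq (q n b l th x : ℝ) (hq1 : q < 1) (hn : 0 < n) (ht0 : 0 ≤ th) (ht1 : th ≤ 1) (hx0 : 0 ≤ x)
   (hq0 : 0 < q)
   (hxl : x^2 = 2*l*(n*q*(1-q)+b*x)) (hxA : x ≤ n*(1-q)) (hlb : 0.97 ≤ 2*l*b)
   (hF : 0.01*(1-q)*(x+1) ≤ 2*l*(x*(b-(1-q)^2/3) - (1-q)^2*((1+th)/2)/3) + x*(1-2*q) - (th^2+th)*(1-q) + th*(1-th)*q) :
   l ≤ (x-th)*(x+th+1)/(2*(n*q+(x+(1+th)/2)/3)) + (x-th)*(x+th-1)/(2*(n*(1-q))) := by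
  have hA : 0 < n*(1-q) := mul_pos hn (by linarith)
  have hD : 0 < n*q+(x+(1+th)/2)/3 := by positivity
  have hs : 0 ≤ x*(x+(1+th)/2)/3 := by positivity
  have h1 : 0 ≤ (2*l*b - 0.97) * (x*(x+(1+th)/2)/3) := mul_nonneg (by linarith) hs
  have h2 : x*(x+(1+th)/2)/3 ≤ n*(1-q)*(x+1)/3 := by
    have : x*(x+(1+th)/2) ≤ n*(1-q)*(x+1) := mul_le_mul hxA (by linarith) (by positivity) hA.le
    linarith
  have h3 : 0 ≤ th*(1-th)*((x+(1+th)/2)/3) := mul_nonneg (mul_nonneg ht0 (by linarith)) (by positivity)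
  have h4 := mul_le_mul_of_nonneg_left hF hn.le
  have key : 2*l*(n*(1-q))*(n*q+(x+(1+th)/2)/3) ≤ (x-th)*(x+th+1)*(n*(1-q)) + (x-th)*(x+th-1)*(n*q+(x+(1+th)/2)/3) := by
    have e : (x-th)*(x+th+1)*(n*(1-q)) + (x-th)*(x+th-1)*(n*q+(x+(1+th)/2)/3) - 2*l*(n*(1-q))*(n*q+(x+(1+th)/2)/3)
       = n * (2*l*(x*(b-(1-q)^2/3) - (1-q)^2*((1+th)/2)/3) + x*(1-2*q) - (th^2+th)*(1-q) + th*(1-th)*q) + (2*l*b-1)*(x*(x+(1+th)/2)/3) + th*(1-th)*((x+(1+th)/2)/3) := by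
      linear_combination (n*(1-q) + (n*q+(x+(1+th)/2)/3)) * hxl
    nlinarith
  rw [div_add_div _ _ (by positivity) (by positivity), le_div_iff₀ (by positivity)]
  linarith

noncomputable def Gf (n q th y : ℝ) : ℝ :=
  (y-th)*(y+th+1)/(2*(n*q+(y+(1+th)/2)/3)) + (y-th)*(y+th-1)/(2*(n*(1-q)))

theorem Gf_mono (n q th x X : ℝ) (hq1 : q < 1) (hn : 0 < n) (ht0 : 0 ≤ th) (ht1 : th ≤ 1) (hq0 : 0 < q)
   (hx : 1 ≤ x) (hX : x ≤ X) : Gf n q th x ≤ Gf n q th X := by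
  unfold Gf
  have hA : 0 < n*(1-q) := mul_pos hn (by linarith)
  have hB : 0 < n*q := mul_pos hn hq0
  have hx0 : 0 ≤ x := by linarith
  have hX0 : 0 ≤ X := by linarith
  apply add_le_add
  · rw [div_le_div_iff₀ (by positivity) (by positivity)]
    have e : (x-th)*(n*q+(X+(1+th)/2)/3) ≤ (X-th)*(n*q+(x+(1+th)/2)/3) := by nlinarith
    have h0 : 0 ≤ (X-th)*(n*q+(x+(1+th)/2)/3) := mul_nonneg (by linarith) (by positivity)
    have := mul_le_mul e (by linarith : x+th+1 ≤ X+th+1) (by linarith) h0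
    linarith
  · apply div_le_div_of_nonneg_right _ (by positivity)
    exact mul_le_mul (by linarith) (by linarith) (by linarith) (by linarith)

theorem Gf_step (n q th y : ℝ) (hq1 : q < 1) (hn : 0 < n) (ht0 : 0 ≤ th) (ht1 : th ≤ 1) (hq0 : 0 < q)
   (hy : th ≤ y) : Gf n q th (y+1) ≤ Gf n q th y + (2*(y+1)/(2*(n*q)+(y+1)) + y/(n*(1-q))) := by
  unfold Gf
  have hA : 0 < n*(1-q) := mul_pos hn (by linarith)
  have hB : 0 < n*q := mul_pos hn hq0
  have e2 : (y+1-th)*(y+1+th-1)/(2*(n*(1-q))) = (y-th)*(y+th-1)/(2*(n*(1-q))) + y/(n*(1-q)) := by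
    field_simp; ring
  rw [e2]
  generalize n*q = B at *
  have hy0 : 0 ≤ y := by linarith
  have : (y+1-th)*(y+1+th+1)/(2*(B+(y+1+(1+th)/2)/3)) ≤ (y-th)*(y+th+1)/(2*(B+(y+(1+th)/2)/3)) + 2*(y+1)/(2*B+(y+1)) := by
    rw [div_add_div _ _ (by positivity) (by positivity), div_le_div_iff₀ (by positivity) (by positivity), ← sub_nonneg]
    have e : ((y-th)*(y+th+1)*(2*B+(y+1)) + 2*(B+(y+(1+th)/2)/3)*(2*(y+1)))*(2*(B+(y+1+(1+th)/2)/3)) - (y+1-th)*(y+1+th+1)*(2*(B+(y+(1+th)/2)/3)*(2*B+(y+1)))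
      = 2*((B+(y+1+(1+th)/2)/3) * (2*th*(y-th)/3) + (y-th)*((y+1)^2+(y+1)-th^2-th)/9) := by ring
    rw [e]
    have a1 : 0 ≤ y - th := by linarith
    have a2 : 0 ≤ (y+1)^2+(y+1)-th^2-th := by nlinarith
    positivity
  linarith

theorem exp_pade (y : ℝ) : Real.exp y * (6 - 2*y) ≤ 6 + 4*y + y^2 := by
  let f1 : ℝ → ℝ := fun y => 4 + 2*y - Real.exp y * (4 - 2*y)
  let f : ℝ → ℝ := fun y => 6 + 4*y + y^2 - Real.exp y * (6 - 2*y)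
  have d1 : ∀ y, HasDerivAt f1 (2 - Real.exp y * (2 - 2*y)) y := by
    intro y
    have h := (((hasDerivAt_id y).const_mul 2).const_add 4).sub ((Real.hasDerivAt_exp y).mul (((hasDerivAt_id y).const_mul 2).const_sub 4))
    refine HasDerivAt.congr_deriv h ?_
    simp only [id]; ring
  have d0 : ∀ y, HasDerivAt f (f1 y) y := by
    intro y
    have h := ((((hasDerivAt_id y).const_mul 4).const_add 6).add (hasDerivAt_pow 2 y)).sub ((Real.hasDerivAt_exp y).mul (((hasDerivAt_id y).const_mul 2).const_sub 6))
    refine HasDerivAt.congr_deriv h ?_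
    simp only [id, f1]; push_cast; ring
  have m1 : Monotone f1 := by
    apply monotone_of_deriv_nonneg (fun y => (d1 y).differentiableAt)
    intro y
    rw [(d1 y).deriv]
    have h := Real.add_one_le_exp (-y)
    have h2 : Real.exp y * Real.exp (-y) = 1 := by rw [← Real.exp_add]; simp
    nlinarith [mul_le_mul_of_nonneg_left h (Real.exp_pos y).le]
  have f10 : f1 0 = 0 := by simp [f1]
  have f0 : f 0 = 0 := by simp [f]
  have hc : Continuous f := continuous_iff_continuousAt.2 fun y => (d0 y).continuousAt
  have hf : 0 ≤ f y := by
    rcases le_total 0 y with h | h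
    · have : MonotoneOn f (Set.Ici 0) := by
        apply monotoneOn_of_deriv_nonneg (convex_Ici 0) hc.continuousOn (fun y _ => (d0 y).differentiableAt.differentiableWithinAt)
        intro z hz
        rw [(d0 z).deriv, ← f10]
        rw [interior_Ici] at hz
        exact m1 (le_of_lt hz)
      rw [← f0]; exact this (by simp) h h
    · have : AntitoneOn f (Set.Iic 0) := by
        apply antitoneOn_of_deriv_nonpos (convex_Iic 0) hc.continuousOn (fun y _ => (d0 y).differentiableAt.differentiableWithinAt)
        intro z hz
        rw [(d0 z).deriv, ← f10]
        rw [interior_Iic] at hz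
        exact m1 (le_of_lt hz)
      rw [← f0]; exact this h (by simp) h
  simp only [f] at hf
  linarith

theorem exp_bern (y la : ℝ) (hy : y ≤ la) (hla : la < 3) : Real.exp y ≤ 1 + y + y^2/(2*(1-la/3)) := by
  have h := exp_pade y
  have h1 : Real.exp y ≤ (6 + 4*y + y^2)/(6-2*y) := by rw [le_div_iff₀ (by linarith)]; exact h
  have h2 : (6 + 4*y + y^2)/(6-2*y) = 1 + y + y^2/(2*(1-y/3)) := by
    have : 6-2*y ≠ 0 := by linarith
    have : 1-y/3 ≠ 0 := by linarith
    have h6 : 6 - 2*y = 2*(3-y) := by ring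
    have h7 : 1 - y/3 = (3-y)/3 := by ring
    have : 3-y ≠ 0 := by linarith
    rw [h6, h7]
    field_simp; ring
  have h3 : y^2/(2*(1-y/3)) ≤ y^2/(2*(1-la/3)) := by
    apply div_le_div_of_nonneg_left (sq_nonneg y) <;> linarith
  linarith

noncomputable def bt (n : ℕ) (q : ℝ) (i : ℕ) : ℝ := (n.choose i : ℝ) * q^i * (1-q)^(n-i)

noncomputable def bT (n : ℕ) (q : ℝ) (k : ℕ) : ℝ := ∑ i ∈ Finset.range (n+1), if k ≤ i then bt n q i else 0

theorem bt_nonneg (n : ℕ) (q : ℝ) (i : ℕ) (hq0 : 0 < q) (hq1 : q < 1) : 0 ≤ bt n q i := by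
  unfold bt
  have : 0 ≤ 1 - q := by linarith
  positivity

theorem bt_zero (n : ℕ) (q : ℝ) (i : ℕ) (h : n < i) : bt n q i = 0 := by
  simp [bt, Nat.choose_eq_zero_of_lt h]

theorem bt_succ (n : ℕ) (q : ℝ) (i : ℕ) (h : i ≤ n) :
    bt n q (i+1) * ((i+1) * (1-q)) = ((n:ℝ) - i) * q * bt n q i := by
  rcases h.eq_or_lt with h | h
  · subst h; rw [bt_zero _ _ _ (Nat.lt_succ_self _)]; ring
  · have h1 := Nat.choose_succ_right_eq n i
    have h2 : (n.choose (i+1) : ℝ) * (i+1) = n.choose i * ((n:ℝ) - i) := by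
      rw [← Nat.cast_sub h.le]; exact_mod_cast h1
    have h3 : n - i = (n - (i+1)) + 1 := by omega
    unfold bt
    rw [h3, pow_succ, pow_succ]
    linear_combination (q^i*q*(1-q)^(n-(i+1))*(1-q)) * h2

theorem bT_nonneg (n : ℕ) (q : ℝ) (k : ℕ) (hq0 : 0 < q) (hq1 : q < 1) : 0 ≤ bT n q k := by
  unfold bT
  refine Finset.sum_nonneg fun i _ => ?_
  split_ifs
  · exact bt_nonneg n q i hq0 hq1
  · exact le_rfl

theorem bT_succ (n : ℕ) (q : ℝ) (k : ℕ) (hq0 : 0 < q) (hq1 : q < 1) :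
    bT n q (k+1) * ((k+1) * (1-q)) ≤ ((n:ℝ) - k) * q * bT n q k := by
  have e : bT n q (k+1) = ∑ i ∈ Finset.range (n+1), if k ≤ i then bt n q (i+1) else 0 := by
    unfold bT
    rw [Finset.sum_range_succ', Finset.sum_range_succ _ n, bt_zero n q (n+1) (Nat.lt_succ_self _)]
    simp
  rw [e, bT, Finset.sum_mul, Finset.mul_sum]
  apply Finset.sum_le_sum
  intro i hi
  have hi' : i ≤ n := by simpa [Nat.lt_succ_iff] using hi
  split_ifs with hk
  · have h := bt_succ n q i hi'
    have hk' : (k:ℝ) ≤ i := by exact_mod_cast hk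
    have b0 := bt_nonneg n q i hq0 hq1
    have b1 := bt_nonneg n q (i+1) hq0 hq1
    have h1 : bt n q (i+1) * ((k+1) * (1-q)) ≤ bt n q (i+1) * ((i+1) * (1-q)) := by
      apply mul_le_mul_of_nonneg_left _ b1
      apply mul_le_mul_of_nonneg_right <;> linarith
    have h2 : ((n:ℝ) - i) * q * bt n q i ≤ ((n:ℝ) - k) * q * bt n q i := by
      apply mul_le_mul_of_nonneg_right _ b0
      apply mul_le_mul_of_nonneg_right _ hq0.le
      linarith
    linarith
  · simp

theorem ratio_exp (n q k : ℝ) (hn : 0 < n) (hq0 : 0 < q) (hq1 : q < 1) (hk : n*q ≤ k) :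
    (n - k) * q ≤ (k+1)*(1-q) * Real.exp (-(2*(k-n*q+1)/(2*(n*q)+(k-n*q+1)) + (k-n*q)/(n*(1-q)))) := by
  have hA : 0 < n*(1-q) := mul_pos hn (by linarith)
  have hB : 0 < n*q := mul_pos hn hq0
  have hz : 0 < k-n*q+1 := by linarith
  have h1 := Real.one_sub_le_exp_neg ((k-n*q)/(n*(1-q)))
  have h2 := Real.le_log_one_add_of_nonneg (x := (k-n*q+1)/(n*q)) (by positivity)
  have e2 : 2 * ((k-n*q+1)/(n*q)) / ((k-n*q+1)/(n*q) + 2) = 2*(k-n*q+1)/(2*(n*q)+(k-n*q+1)) := by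
    have : 0 < 2*(n*q)+(k-n*q+1) := by positivity
    have h3 : (k-n*q+1)/(n*q) + 2 = (2*(n*q)+(k-n*q+1))/(n*q) := by field_simp; ring
    rw [h3]; field_simp
  rw [e2] at h2
  have e3 : 1 + (k-n*q+1)/(n*q) = (k+1)/(n*q) := by field_simp; ring
  have h4 : ((k+1)/(n*q))⁻¹ ≤ Real.exp (-(2*(k-n*q+1)/(2*(n*q)+(k-n*q+1)))) := by
    rw [Real.exp_neg]
    apply inv_anti₀ (Real.exp_pos _)
    rw [← e3, ← Real.le_log_iff_exp_le (by positivity)]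
    exact h2
  rw [neg_add, Real.exp_add]
  have hk1 : 0 < k + 1 := by linarith
  have h1q : 0 < 1 - q := by linarith
  have e5 : (n - k) * q = (k+1)*(1-q) * (((k+1)/(n*q))⁻¹ * (1 - (k-n*q)/(n*(1-q)))) := by
    field_simp; ring
  rw [e5]
  apply mul_le_mul_of_nonneg_left _ (by positivity)
  calc _ ≤ ((k+1)/(n*q))⁻¹ * Real.exp (-((k-n*q)/(n*(1-q)))) := mul_le_mul_of_nonneg_left h1 (by positivity)
    _ ≤ _ := mul_le_mul_of_nonneg_right h4 (Real.exp_pos _).le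

theorem bT_geo (n : ℕ) (q : ℝ) (c j : ℕ) (th : ℝ) (hn : 0 < n) (hq0 : 0 < q) (hq1 : q < 1)
    (ht0 : 0 ≤ th) (ht1 : th ≤ 1) (hc : (c:ℝ) = n*q + th) :
    bT n q (c+j) ≤ bT n q c * Real.exp (-Gf n q th (th+j)) := by
  have hn' : (0:ℝ) < n := by exact_mod_cast hn
  induction j with
  | zero => simp [Gf]
  | succ j ih =>
    have h1 := bT_succ n q (c+j) hq0 hq1
    have hk : ((c+j : ℕ):ℝ) = n*q + (th + j) := by push_cast; linarith
    have h2 := ratio_exp n q ((c+j : ℕ):ℝ) hn' hq0 hq1 (by rw [hk]; have : (0:ℝ) ≤ j := by positivity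
                                                           linarith)
    have h3 := Gf_step n q th (th+j) hq1 hn' ht0 ht1 hq0 (by have : (0:ℝ) ≤ j := by positivity
                                                             linarith)
    have e : ((c+j : ℕ):ℝ) - n*q = th + j := by rw [hk]; ring
    rw [e] at h2
    have hpos : 0 < (((c+j : ℕ):ℝ)+1)*(1-q) := mul_pos (by positivity) (by linarith)
    have b0 := bT_nonneg n q (c+j) hq0 hq1
    have h4 : bT n q (c+j+1) ≤ Real.exp (-(2*(th+j+1)/(2*(n*q)+(th+j+1)) + (th+j)/(n*(1-q)))) * bT n q (c+j) := by
      have := h1.trans (mul_le_mul_of_nonneg_right h2 b0)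
      rw [← mul_le_mul_iff_left₀ hpos]
      linarith
    calc bT n q (c+(j+1)) ≤ _ := h4
      _ ≤ Real.exp (-(2*(th+j+1)/(2*(n*q)+(th+j+1)) + (th+j)/(n*(1-q)))) * (bT n q c * Real.exp (-Gf n q th (th+j))) :=
          mul_le_mul_of_nonneg_left ih (Real.exp_pos _).le
      _ = bT n q c * Real.exp (-(Gf n q th (th+j) + (2*(th+j+1)/(2*(n*q)+(th+j+1)) + (th+j)/(n*(1-q))))) := by
          rw [neg_add (Gf _ _ _ _), Real.exp_add]; ring
      _ ≤ _ := by
          apply mul_le_mul_of_nonneg_left _ (bT_nonneg n q c hq0 hq1)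
          apply Real.exp_le_exp.2
          push_cast
          rw [← add_assoc th]
          linarith

theorem bT_bern (n : ℕ) (q : ℝ) (k : ℕ) (x b : ℝ) (hn : 0 < n) (hq0 : 0 < q) (hq1 : q < 1)
    (hx : 0 ≤ x) (hk : n*q + x ≤ k) (hb : 1/3 ≤ b) :
    bT n q k ≤ Real.exp (-(x^2/(2*(n*q*(1-q)+b*x)))) := by
  have hn' : (0:ℝ) < n := by exact_mod_cast hn
  have h1q : 0 < 1 - q := by linarith
  have hV : 0 < n*q*(1-q) := by positivity
  set V := n*q*(1-q) with hVd
  set la := x/(V+x/3) with hla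
  have hW : 0 < V + x/3 := by positivity
  have hla0 : 0 ≤ la := by positivity
  have hla3 : la < 3 := by rw [hla, div_lt_iff₀ hW]; linarith
  -- Markov
  have h1 : bT n q k ≤ Real.exp (-(la*k)) * (q * Real.exp la + (1-q))^n := by
    rw [add_pow, Finset.mul_sum, bT]
    apply Finset.sum_le_sum
    intro i _
    have hb0 := bt_nonneg n q i hq0 hq1
    have e : Real.exp (-(la*k)) * ((q * Real.exp la)^i * (1-q)^(n-i) * (n.choose i)) = Real.exp (la*(i-k)) * bt n q i := by
      rw [mul_pow, ← Real.exp_nat_mul, bt, show la*((i:ℝ)-k) = -(la*k) + i*la by ring, Real.exp_add]; ring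
    rw [e]
    split_ifs with h
    · have h' : (k:ℝ) ≤ i := by exact_mod_cast h
      have : 1 ≤ Real.exp (la*(i-k)) := Real.one_le_exp (mul_nonneg hla0 (by linarith))
      nlinarith
    · positivity
  set g := 1/(2*(1-la/3)) with hg
  have h2 : q * Real.exp la + (1-q) ≤ Real.exp (la*q + q*(1-q)*(la^2*g)) := by
    have a1 := exp_bern (la*(1-q)) la (by nlinarith) hla3
    have a2 := exp_bern (-(la*q)) la (by nlinarith) hla3
    have a3 := Real.add_one_le_exp (q*(1-q)*(la^2*g))
    have e : q * Real.exp la + (1-q) = Real.exp (la*q) * (q * Real.exp (la*(1-q)) + (1-q) * Real.exp (-(la*q))) := by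
      have e1 : Real.exp la = Real.exp (la*q) * Real.exp (la*(1-q)) := by rw [← Real.exp_add]; congr 1; ring
      have e2 : Real.exp (la*q) * Real.exp (-(la*q)) = 1 := by rw [← Real.exp_add]; simp
      rw [e1]; linear_combination (-(1-q)) * e2
    rw [e, Real.exp_add]
    apply mul_le_mul_of_nonneg_left _ (Real.exp_pos _).le
    rw [div_eq_mul_one_div, ← hg] at a1 a2
    have b1 := mul_le_mul_of_nonneg_left a1 hq0.le
    have b2 := mul_le_mul_of_nonneg_left a2 h1q.le
    refine le_trans (add_le_add b1 b2) (le_trans (le_of_eq ?_) a3)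
    ring
  have h3 : (q * Real.exp la + (1-q))^n ≤ Real.exp (n*(la*q + q*(1-q)*(la^2*g))) := by
    rw [Real.exp_nat_mul]
    exact pow_le_pow_left₀ (by positivity) h2 n
  calc bT n q k ≤ _ := h1
    _ ≤ Real.exp (-(la*k)) * Real.exp (n*(la*q + q*(1-q)*(la^2*g))) := mul_le_mul_of_nonneg_left h3 (Real.exp_pos _).le
    _ = Real.exp (-(la*k) + n*(la*q + q*(1-q)*(la^2*g))) := by rw [Real.exp_add]
    _ ≤ _ := by
      apply Real.exp_le_exp.2
      have e1 : V*(la^2*g) = la*x/2 := by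
        have : 1 - la/3 = V/(V+x/3) := by rw [hla]; field_simp; ring
        rw [hg, this, hla]; field_simp
      have e2 : n*(la*q + q*(1-q)*(la^2*g)) = la*(n*q) + la*x/2 := by rw [← e1, hVd]; ring
      rw [e2]
      have e3 : x^2/(2*(V+b*x)) ≤ la*x/2 := by
        have : la*x/2 = x^2/(2*(V+x/3)) := by rw [hla]; field_simp
        rw [this]
        apply div_le_div_of_nonneg_left (sq_nonneg x) (by positivity)
        nlinarith
      nlinarith [mul_le_mul_of_nonneg_left hk hla0]

theorem bT_zero (n : ℕ) (q : ℝ) (k : ℕ) (h : n < k) : bT n q k = 0 := by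
  unfold bT
  apply Finset.sum_eq_zero
  intro i hi
  have : i ≤ n := by simpa [Nat.lt_succ_iff] using hi
  rw [if_neg (by omega)]

theorem bt_refl (n : ℕ) (q : ℝ) (i : ℕ) (h : i ≤ n) : bt n (1-q) (n-i) = bt n q i := by
  unfold bt
  rw [Nat.choose_symm h, Nat.sub_sub_self h, sub_sub_cancel]; ring

theorem bT_split (n : ℕ) (q : ℝ) (c : ℕ) (hc : c ≤ n) : bT n q c + bT n (1-q) (n+1-c) = 1 := by
  have e : bT n (1-q) (n+1-c) = ∑ i ∈ Finset.range (n+1), if c ≤ i then 0 else bt n q i := by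
    unfold bT
    rw [← Finset.sum_range_reflect]
    apply Finset.sum_congr rfl
    intro i hi
    have hi' : i ≤ n := by simpa [Nat.lt_succ_iff] using hi
    have : n + 1 - 1 - i = n - i := by omega
    rw [this, bt_refl n q i hi']
    by_cases h : c ≤ i
    · rw [if_pos h, if_neg (by omega)]
    · rw [if_neg h, if_pos (by omega)]
  rw [e, bT, ← Finset.sum_add_distrib]
  have : ∀ i ∈ Finset.range (n+1), ((if c ≤ i then bt n q i else 0) + (if c ≤ i then 0 else bt n q i)) = q^i*(1-q)^(n-i)*(n.choose i) := by
    intro i _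
    unfold bt
    split_ifs <;> ring
  rw [Finset.sum_congr rfl this, ← add_pow]
  simp

theorem bT_cmp (n : ℕ) (q : ℝ) (c k : ℕ) (th x b l : ℝ) (hn : 0 < n) (hq0 : 0 < q) (hq1 : q < 1)
    (ht0 : 0 ≤ th) (ht1 : th ≤ 1) (hc : (c:ℝ) = n*q + th) (hx : 1 ≤ x) (hk : n*q + x ≤ k)
   (hxl : x^2 = 2*l*(n*q*(1-q)+b*x)) (hxA : x ≤ n*(1-q)) (hlb : 0.97 ≤ 2*l*b)
   (hF : 0.01*(1-q)*(x+1) ≤ 2*l*(x*(b-(1-q)^2/3) - (1-q)^2*((1+th)/2)/3) + x*(1-2*q) - (th^2+th)*(1-q) + th*(1-th)*q) :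
    bT n q k ≤ bT n q c * Real.exp (-l) := by
  have hn' : (0:ℝ) < n := by exact_mod_cast hn
  have hck : c ≤ k := by
    have : (c:ℝ) ≤ k := by linarith
    exact_mod_cast this
  obtain ⟨j, rfl⟩ := Nat.exists_eq_add_of_le hck
  refine (bT_geo n q c j th hn hq0 hq1 ht0 ht1 hc).trans ?_
  apply mul_le_mul_of_nonneg_left _ (bT_nonneg n q c hq0 hq1)
  apply Real.exp_le_exp.2
  apply neg_le_neg
  have h1 := fin_ineq q n b l th x hq1 hn' ht0 ht1 (by linarith) hq0 hxl hxA hlb hF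
  push_cast at hk
  exact h1.trans (Gf_mono n q th x (th+j) hq1 hn' ht0 ht1 hq0 hx (by linarith))

theorem pair_bound (n p m : ℕ) (hn : 0 < n) (hp : 3 ≤ p) (hm : 1 ≤ m) (hmp : m < p) (q x : ℝ)
    (hq : q = (m:ℝ)/p) (hx : 0 ≤ x) (ku kl : ℕ) (hku : n*q + x ≤ ku) (hkl : n*(1-q) + x ≤ kl)
    (hE : Real.log p ≤ x^2/(2*(n*q*(1-q)+(1+q)/3*x))) :
    bT n q ku + bT n (1-q) kl ≤ Real.exp (-(x^2/(2*(n*q*(1-q)+(1+q)/3*x)))) := by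
  have hn' : (0:ℝ) < n := by exact_mod_cast hn
  have hp0 : (0:ℝ) < p := by exact_mod_cast (by omega : 0 < p)
  have hm0 : (0:ℝ) < m := by exact_mod_cast hm
  have hq0 : 0 < q := by rw [hq]; positivity
  have hq1 : q < 1 := by rw [hq, div_lt_one hp0]; exact_mod_cast hmp
  have h1q : 0 < 1 - q := by linarith
  have hqp : 1 ≤ q * p := by rw [hq]; field_simp; exact_mod_cast hm
  have hq1p : 1 ≤ (1 - q) * p := by
    rw [hq]; field_simp
    have : (m:ℝ) + 1 ≤ p := by exact_mod_cast hmp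
    linarith
  have hW : 0 < n*q*(1-q)+(1+q)/3*x := by positivity
  by_cases hA : n*(1-q) < x
  · rw [bT_zero n q ku, zero_add]
    · have := bT_bern n (1-q) kl x ((1+q)/3) hn h1q (by linarith) hx hkl (by linarith)
      rwa [show n*(1-q)*(1-(1-q)) = n*q*(1-q) by ring] at this
    · have : (n:ℝ) < ku := by linarith
      exact_mod_cast this
  by_cases hB : n*q < x
  · rw [bT_zero n (1-q) kl, add_zero]
    · exact bT_bern n q ku x ((1+q)/3) hn hq0 hq1 hx hku (by linarith)
    · have : (n:ℝ) < kl := by linarith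
      exact_mod_cast this
  push Not at hA hB
  set l := x^2/(2*(n*q*(1-q)+(1+q)/3*x)) with hl
  have hxl : x^2 = 2*l*(n*q*(1-q)+(1+q)/3*x) := by rw [hl]; field_simp
  -- lower bounds on l
  have hl3 : 1.098 ≤ l := by
    have h3 : Real.log 3 ≤ Real.log p := Real.log_le_log (by norm_num) (by exact_mod_cast hp)
    have := Real.log_three_gt_d9
    linarith
  have hlb : 3 ≤ 2*l*(1+q) ∨ (1/3 ≤ q ∧ 0.97 ≤ 2*l*((1+q)/3)) := by
    rcases (by omega : p = 3 ∨ p = 4 ∨ 5 ≤ p) with h | h | h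
    · right
      rw [h] at hqp
      push_cast at hqp
      constructor
      · linarith
      · nlinarith
    · left
      have h4 : Real.log p = 2 * Real.log 2 := by
        rw [h, show ((4:ℕ):ℝ) = 2^2 by norm_num, Real.log_pow]; norm_num
      have := Real.log_two_gt_d9
      rw [h] at hqp
      push_cast at hqp
      nlinarith
    · left
      have h3 : Real.log 5 ≤ Real.log p := Real.log_le_log (by norm_num) (by exact_mod_cast h)
      have := Real.log_five_gt_d9
      nlinarith
  have hlb' : 0.97 ≤ 2*l*((1+q)/3) := by
    rcases hlb with h | h
    · linarith
    · exact h.2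
  have hl0 : 0 < l := by linarith
  have hxpos : 0 < x := by
    rcases hx.eq_or_lt with h | h
    · have : l = 0 := by rw [hl, ← h]; simp
      linarith
    · exact h
  have hx1 : 2*l*(4-2*q)/3 ≤ x := by
    have : x * (1-q) ≤ n*q*(1-q) := mul_le_mul_of_nonneg_right hB h1q.le
    have h2 : 2*l*(x*(1-q)+(1+q)/3*x) ≤ x * x := by
      rw [← sq, hxl]; apply mul_le_mul_of_nonneg_left <;> linarith
    have h3 : (2*l*(4-2*q)/3) * x ≤ x * x := by linarith
    exact le_of_mul_le_mul_right h3 hxpos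
  have hx2 : 2*l*(1+4*q)/3 ≤ x := by
    have : x * q ≤ n*(1-q)*q := mul_le_mul_of_nonneg_right hA hq0.le
    have h2 : 2*l*(x*q+(1+q)/3*x) ≤ x * x := by
      rw [← sq, hxl]; apply mul_le_mul_of_nonneg_left <;> linarith
    have h3 : (2*l*(1+4*q)/3) * x ≤ x * x := by linarith
    exact le_of_mul_le_mul_right h3 hxpos
  have hxx1 : 1 ≤ x := by
    rcases le_total q (1/2) with h | h <;> nlinarith
  -- center
  obtain ⟨c, hcd⟩ : ∃ c, c = ⌈(n:ℝ)*q⌉₊ := ⟨_, rfl⟩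
  have hc1 : n*q ≤ c := by rw [hcd]; exact Nat.le_ceil _
  have hc2 : (c:ℝ) < n*q + 1 := by rw [hcd]; exact Nat.ceil_lt_add_one (by positivity)
  have hcn : c ≤ n := by
    rw [hcd]; apply Nat.ceil_le.2; nlinarith
  have hs := bT_split n q c hcn
  have hc' : ((n+1-c : ℕ):ℝ) = n*(1-q) + (1 - (c - n*q)) := by
    rw [Nat.cast_sub (by omega)]; push_cast; ring
  have hU := bT_cmp n q c ku (c - n*q) x ((1+q)/3) l hn hq0 hq1 (by linarith) (by linarith) (by ring) hxx1 hku
    hxl hA hlb' (by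
      have := F_U q l (c-n*q) x hq0.le hq1.le hl3 (by linarith) (by linarith) hx1
      rwa [show (1+q)/3 - (1-q)^2/3 = q - q^2/3 by ring])
  have hL := bT_cmp n (1-q) (n+1-c) kl (1-(c - n*q)) x ((1+q)/3) l hn h1q (by linarith) (by linarith) (by linarith) hc' hxx1 hkl
    (by rw [hxl]; ring) (by linarith) hlb' (by
      have := F_L q l (1-(c-n*q)) x hq0.le hq1.le hl3 (by linarith) (by linarith) hx1 hx2 (by
        rcases hlb with h | h
        · exact Or.inl h
        · exact Or.inr h.1)
      rw [show (1 - (1-q)) = q by ring, show (1+q)/3 - q^2/3 = (1+q-q^2)/3 by ring, show 1 - 2*(1-q) = 2*q-1 by ring]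
      exact this)
  calc _ ≤ (bT n q c + bT n (1-q) (n+1-c)) * Real.exp (-l) := by rw [add_mul]; exact add_le_add hU hL
    _ = _ := by rw [hs, one_mul]

section
open scoped Classical

theorem count_tail {α : Type*} [Fintype α] (P : α → Prop) (n k : ℕ) (q : ℝ)
    (hM : 0 < Fintype.card α)
    (hq : ((Finset.univ.filter P).card : ℝ) = q * Fintype.card α) :
    ((Finset.univ.filter (fun ω : Fin n → α => k ≤ (Finset.univ.filter (fun i => P (ω i))).card)).card : ℝ)
      = (Fintype.card α : ℝ)^n * bT n q k := by
  have hq' : ((Finset.univ.filter (fun a => ¬ P a)).card : ℝ) = (1-q) * Fintype.card α := by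
    have h := Finset.card_filter_add_card_filter_not (s := (Finset.univ : Finset α)) P
    rw [Finset.card_univ] at h
    have h' : ((Finset.univ.filter P).card : ℝ) + ((Finset.univ.filter (fun a => ¬ P a)).card : ℝ) = Fintype.card α := by
      exact_mod_cast h
    linarith
  have fib : ∀ T : Finset (Fin n), ((Finset.univ.filter (fun ω : Fin n → α => Finset.univ.filter (fun i => P (ω i)) = T)).card : ℝ)
      = (Fintype.card α : ℝ)^n * (q^T.card * (1-q)^(n-T.card)) := by
    intro T
    have e : (Finset.univ.filter (fun ω : Fin n → α => Finset.univ.filter (fun i => P (ω i)) = T))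
        = Fintype.piFinset (fun i => Finset.univ.filter (fun a => P a ↔ i ∈ T)) := by
      ext ω
      simp only [Finset.mem_filter, Finset.mem_univ, true_and, Fintype.mem_piFinset, Finset.ext_iff]
    rw [e, Fintype.card_piFinset]
    push_cast
    have e2 : ∀ i : Fin n, ((Finset.univ.filter (fun a => P a ↔ i ∈ T)).card : ℝ) = if i ∈ T then q * Fintype.card α else (1-q) * Fintype.card α := by
      intro i
      by_cases h : i ∈ T
      · simp [h, hq]
      · simp [h, hq']
    rw [Finset.prod_congr rfl (fun i _ => e2 i), Finset.prod_ite, Finset.prod_const, Finset.prod_const]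
    have c1 : (Finset.univ.filter (fun i => i ∈ T)).card = T.card := by simp
    have c2 : (Finset.univ.filter (fun i => i ∉ T)).card = n - T.card := by
      rw [Finset.filter_not, Finset.card_sdiff_of_subset (Finset.filter_subset _ _), c1]; simp
    have c3 : T.card ≤ n := by simpa using Finset.card_le_univ T
    rw [c1, c2, mul_pow, mul_pow]
    obtain ⟨d, hd⟩ := Nat.exists_eq_add_of_le c3
    have : n - T.card = d := by omega
    have hpw : (Fintype.card α : ℝ)^n = (Fintype.card α:ℝ)^T.card * (Fintype.card α:ℝ)^d := by
      rw [← pow_add, ← hd]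
    rw [this, hpw]; ring
  rw [Finset.card_eq_sum_card_fiberwise (f := fun ω : Fin n → α => Finset.univ.filter (fun i => P (ω i))) (t := Finset.univ.powerset) (by intro ω _; simp)]
  push_cast
  have e3 : ∀ T ∈ (Finset.univ : Finset (Fin n)).powerset, (((Finset.univ.filter (fun ω : Fin n → α => k ≤ (Finset.univ.filter (fun i => P (ω i))).card)).filter (fun ω => Finset.univ.filter (fun i => P (ω i)) = T)).card : ℝ)
      = (fun t : ℕ => if k ≤ t then (Fintype.card α : ℝ)^n * (q^t * (1-q)^(n-t)) else 0) T.card := by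
    intro T _
    rw [Finset.filter_filter]
    by_cases h : k ≤ T.card
    · simp only [h, if_true]
      rw [← fib T]
      congr 2
      ext ω
      simp only [Finset.mem_filter, Finset.mem_univ, true_and]
      constructor
      · rintro ⟨_, h2⟩; exact h2
      · intro h2; exact ⟨by rw [h2]; exact h, h2⟩
    · simp only [h, if_false]
      rw [Nat.cast_eq_zero, Finset.card_eq_zero, Finset.filter_eq_empty_iff]
      rintro ω _ ⟨h1, h2⟩
      rw [h2] at h1; exact h h1
  have e4 := Finset.sum_powerset_apply_card (fun t : ℕ => if k ≤ t then (Fintype.card α : ℝ)^n * (q^t * (1-q)^(n-t)) else 0) (x := (Finset.univ : Finset (Fin n)))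
  refine (Finset.sum_congr rfl e3).trans (e4.trans ?_)
  rw [bT, Finset.mul_sum, Finset.card_univ, Fintype.card_fin]
  apply Finset.sum_congr rfl
  intro i _
  unfold bt
  split_ifs
  · rw [nsmul_eq_mul]; ring
  · simp

theorem card_in_range (p m : ℕ) (hp : 0 < p) (j : Fin p) :
    ((Finset.univ.filter (fun σ : Fin m ↪ Fin p => j ∈ Set.range σ)).card : ℝ)
      = ((m:ℝ)/p) * Fintype.card (Fin m ↪ Fin p) := by
  have hsym : ∀ i : Fin p, (Finset.univ.filter (fun σ : Fin m ↪ Fin p => i ∈ Set.range σ)).card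
      = (Finset.univ.filter (fun σ : Fin m ↪ Fin p => j ∈ Set.range σ)).card := by
    intro i
    apply Finset.card_equiv ((Equiv.refl (Fin m)).embeddingCongr (Equiv.swap i j))
    intro σ
    simp only [Finset.mem_filter, Finset.mem_univ, true_and, Set.mem_range]
    constructor
    · rintro ⟨k, hk⟩
      exact ⟨k, by simp [Equiv.embeddingCongr, hk]⟩
    · rintro ⟨k, hk⟩
      refine ⟨k, ?_⟩
      have : Equiv.swap i j (σ k) = j := by simpa [Equiv.embeddingCongr] using hk
      rw [Equiv.swap_apply_eq_iff] at this
      simpa using this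
  have hdouble : ∑ i : Fin p, (Finset.univ.filter (fun σ : Fin m ↪ Fin p => i ∈ Set.range σ)).card
      = ∑ σ : Fin m ↪ Fin p, (Finset.univ.filter (fun i : Fin p => i ∈ Set.range σ)).card := by
    simp only [Finset.card_filter]
    exact Finset.sum_comm
  have hr : ∀ σ : Fin m ↪ Fin p, (Finset.univ.filter (fun i : Fin p => i ∈ Set.range σ)).card = m := by
    intro σ
    have : (Finset.univ.filter (fun i : Fin p => i ∈ Set.range σ)) = Finset.univ.map σ := by
      ext i; simp
    rw [this]; simp
  rw [Finset.sum_congr rfl (fun i _ => hsym i), Finset.sum_congr rfl (fun σ _ => hr σ)] at hdouble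
  simp only [Finset.sum_const, Finset.card_univ, Fintype.card_fin, smul_eq_mul] at hdouble
  have h : (p:ℝ) * ((Finset.univ.filter (fun σ : Fin m ↪ Fin p => j ∈ Set.range σ)).card : ℝ) = Fintype.card (Fin m ↪ Fin p) * m := by
    exact_mod_cast hdouble
  have : (p:ℝ) ≠ 0 := by positivity
  field_simp
  linarith

noncomputable def Nc {p m n : ℕ} (j : Fin p) (ω : Fin n → (Fin m ↪ Fin p)) : ℕ :=
  (Finset.univ.filter (fun i => j ∈ Set.range (ω i))).card

noncomputable def Mc {p m n : ℕ} (j : Fin p) (ω : Fin n → (Fin m ↪ Fin p)) : ℕ :=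
  (Finset.univ.filter (fun i => ¬ j ∈ Set.range (ω i))).card

theorem Nc_add_Mc {p m n : ℕ} (j : Fin p) (ω : Fin n → (Fin m ↪ Fin p)) : Nc j ω + Mc j ω = n := by
  unfold Nc Mc
  rw [Finset.card_filter_add_card_filter_not]; simp

theorem samp_mul {p m : ℕ} (σ : Fin m ↪ Fin p) :
    sampMatrix σ * (sampMatrix σ)ᵀ = Matrix.diagonal (fun j => if j ∈ Set.range σ then (1:ℝ) else 0) := by
  ext a b
  simp only [Matrix.mul_apply, Matrix.transpose_apply, sampMatrix, Matrix.of_apply, Matrix.diagonal_apply]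
  by_cases hab : a = b
  · subst hab
    simp only [if_true, mul_ite, mul_one, mul_zero]
    by_cases h : a ∈ Set.range σ
    · obtain ⟨k, rfl⟩ := h
      simp
    · have h' : ∀ k, σ k ≠ a := fun k hk => h ⟨k, hk⟩
      simp [h']
  · rw [if_neg hab]
    apply Finset.sum_eq_zero
    intro k _
    by_cases h : σ k = a
    · rw [if_neg (fun h2 => hab (h.symm.trans h2)), mul_zero]
    · rw [if_neg h, zero_mul]

open scoped Matrix.Norms.L2Operator in
theorem spec_le {p m n : ℕ} (ω : Fin n → (Fin m ↪ Fin p)) (t r : ℝ) (ht : 0 ≤ t)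
    (h : ∀ j, |r * ((n:ℝ)⁻¹ * Nc j ω) - 1| ≤ t) :
    specNorm (r • ((n : ℝ)⁻¹ • ∑ i, sampMatrix (ω i) * (sampMatrix (ω i))ᵀ) - 1) ≤ t := by
  have e : (r • ((n : ℝ)⁻¹ • ∑ i, sampMatrix (ω i) * (sampMatrix (ω i))ᵀ) - 1) = Matrix.diagonal (fun j => r * ((n:ℝ)⁻¹ * Nc j ω) - 1) := by
    ext a b
    simp only [samp_mul, Matrix.sub_apply, Matrix.smul_apply, Matrix.sum_apply, Matrix.diagonal_apply, Matrix.one_apply, smul_eq_mul]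
    by_cases hab : a = b
    · subst hab
      simp [Nc]
    · simp [hab]
  rw [e]
  have e2 : specNorm (Matrix.diagonal (fun j : Fin p => r * ((n:ℝ)⁻¹ * Nc j ω) - 1)) = ‖Matrix.diagonal (fun j : Fin p => r * ((n:ℝ)⁻¹ * Nc j ω) - 1)‖ := rfl
  rw [e2, Matrix.l2_opNorm_diagonal, pi_norm_le_iff_of_nonneg ht]
  exact h

theorem prob_ge {Ω : Type*} [Fintype Ω] [Nonempty Ω] (A : Set Ω) (Bad : Finset Ω) (h : ∀ ω, ω ∉ Bad → ω ∈ A) :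
    1 - (Bad.card : ℝ) / Fintype.card Ω ≤ probOf A := by
  unfold probOf
  have hc : (0:ℝ) < Fintype.card Ω := by exact_mod_cast Fintype.card_pos
  rw [sub_le_iff_le_add, ← add_div, le_div_iff₀ hc, one_mul]
  have h1 : (A.toFinset ∪ Bad) = Finset.univ := by
    ext ω; simp only [Finset.mem_union, Set.mem_toFinset, Finset.mem_univ, iff_true]
    by_cases hb : ω ∈ Bad
    · exact Or.inr hb
    · exact Or.inl (h ω hb)
  have h2 := Finset.card_union_le A.toFinset Bad
  rw [h1, Finset.card_univ] at h2
  rw [Set.ncard_eq_toFinset_card']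
  exact_mod_cast h2

theorem dev_cases (n B x q t : ℝ) (N M : ℕ) (hn : 0 < n) (hq : 0 < q) (hNM : (N:ℝ) + M = n) (hB : B = n*q) (hx : x = n*q*t)
    (h1 : N < ⌈n*q+x⌉₊) (h2 : M < ⌈n*(1-q)+x⌉₊) : |q⁻¹ * (n⁻¹ * N) - 1| ≤ t := by
  rw [Nat.lt_ceil] at h1 h2
  have e : q⁻¹ * (n⁻¹ * N) - 1 = (N - n*q)/(n*q) := by field_simp
  rw [e, abs_div, abs_of_pos (by positivity : 0 < n*q), div_le_iff₀ (by positivity), abs_le]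
  constructor <;> nlinarith

end

section
open scoped Classical

theorem cardN {p m : ℕ} (n k : ℕ) (hp : 0 < p) (hM : 0 < Fintype.card (Fin m ↪ Fin p)) (j : Fin p) :
    ((Finset.univ.filter (fun ω : Fin n → (Fin m ↪ Fin p) => k ≤ Nc j ω)).card : ℝ)
      = (Fintype.card (Fin m ↪ Fin p) : ℝ)^n * bT n ((m:ℝ)/p) k := by
  have h := count_tail (fun σ : Fin m ↪ Fin p => j ∈ Set.range σ) n k ((m:ℝ)/p) hM (by
    convert card_in_range p m hp j)
  unfold Nc
  convert h

theorem cardM {p m : ℕ} (n k : ℕ) (hp : 0 < p) (hM : 0 < Fintype.card (Fin m ↪ Fin p)) (j : Fin p) :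
    ((Finset.univ.filter (fun ω : Fin n → (Fin m ↪ Fin p) => k ≤ Mc j ω)).card : ℝ)
      = (Fintype.card (Fin m ↪ Fin p) : ℝ)^n * bT n (1-(m:ℝ)/p) k := by
  suffices hs : ((Finset.univ.filter (fun σ : Fin m ↪ Fin p => ¬ j ∈ Set.range σ)).card : ℝ)
      = (1-(m:ℝ)/p) * Fintype.card (Fin m ↪ Fin p) by
    have h := count_tail (fun σ : Fin m ↪ Fin p => ¬ j ∈ Set.range σ) n k (1-(m:ℝ)/p) hM (by
      convert hs)
    unfold Mc
    convert h
  have h := Finset.card_filter_add_card_filter_not (s := (Finset.univ : Finset (Fin m ↪ Fin p))) (fun σ => j ∈ Set.range σ)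
  rw [Finset.card_univ] at h
  have h' : ((Finset.univ.filter (fun σ : Fin m ↪ Fin p => j ∈ Set.range σ)).card : ℝ) + ((Finset.univ.filter (fun σ : Fin m ↪ Fin p => ¬ j ∈ Set.range σ)).card : ℝ) = Fintype.card (Fin m ↪ Fin p) := by
    exact_mod_cast h
  have h2 := card_in_range p m hp j
  linarith

theorem bad_card {p m : ℕ} (n : ℕ) (S : Finset (Fin p)) (ku kl : ℕ) (hp : 0 < p)
    (hM : 0 < Fintype.card (Fin m ↪ Fin p)) :
    ((Finset.univ.filter (fun ω : Fin n → (Fin m ↪ Fin p) => ∃ j ∈ S, ku ≤ Nc j ω ∨ kl ≤ Mc j ω)).card : ℝ)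
      / Fintype.card (Fin n → (Fin m ↪ Fin p))
      ≤ S.card * (bT n ((m:ℝ)/p) ku + bT n (1-(m:ℝ)/p) kl) := by
  have hc : (Fintype.card (Fin n → (Fin m ↪ Fin p)) : ℝ) = (Fintype.card (Fin m ↪ Fin p) : ℝ)^n := by
    rw [Fintype.card_fun, Fintype.card_fin]; push_cast; rfl
  have hM' : (0:ℝ) < Fintype.card (Fin m ↪ Fin p) := by exact_mod_cast hM
  rw [hc, div_le_iff₀ (by positivity)]
  have hsub : (Finset.univ.filter (fun ω : Fin n → (Fin m ↪ Fin p) => ∃ j ∈ S, ku ≤ Nc j ω ∨ kl ≤ Mc j ω))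
      ⊆ S.biUnion (fun j => (Finset.univ.filter (fun ω : Fin n → (Fin m ↪ Fin p) => ku ≤ Nc j ω)) ∪ (Finset.univ.filter (fun ω : Fin n → (Fin m ↪ Fin p) => kl ≤ Mc j ω))) := by
    intro ω hω
    simpa only [Finset.mem_filter, Finset.mem_univ, true_and, Finset.mem_biUnion, Finset.mem_union] using hω
  have h1 := (Finset.card_le_card hsub).trans Finset.card_biUnion_le
  have h2 := h1.trans (Finset.sum_le_sum (fun j _ => Finset.card_union_le _ _))
  have h3 : ((Finset.univ.filter (fun ω : Fin n → (Fin m ↪ Fin p) => ∃ j ∈ S, ku ≤ Nc j ω ∨ kl ≤ Mc j ω)).card : ℝ)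
      ≤ ∑ j ∈ S, (((Finset.univ.filter (fun ω : Fin n → (Fin m ↪ Fin p) => ku ≤ Nc j ω)).card : ℝ) + ((Finset.univ.filter (fun ω : Fin n → (Fin m ↪ Fin p) => kl ≤ Mc j ω)).card : ℝ)) := by
    exact_mod_cast h2
  refine h3.trans (le_of_eq ?_)
  rw [Finset.sum_congr rfl (fun j _ => by rw [cardN n ku hp hM j, cardM n kl hp hM j]), Finset.sum_const, nsmul_eq_mul]
  ring

theorem exponent_eq (n q t : ℝ) (hn : 0 < n) (hq0 : 0 < q) (hq1 : q < 1) (ht : 0 ≤ t) :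
    -(n * t^2/2) / ((q⁻¹ - 1) + (q⁻¹ + 1)*t/3)
      = -((n*q*t)^2/(2*(n*q*(1-q)+(1+q)/3*(n*q*t)))) := by
  have h1 : 0 < 1 - q := by linarith
  have h2 : (q⁻¹ - 1) + (q⁻¹ + 1)*t/3 = ((1-q) + (1+q)*t/3)/q := by field_simp
  have h3 : 2*(n*q*(1-q)+(1+q)/3*(n*q*t)) = 2*(n*q)*((1-q) + (1+q)*t/3) := by ring
  have h4 : 0 < (1-q) + (1+q)*t/3 := by positivity
  rw [h2, h3]
  generalize (1-q) + (1+q)*t/3 = D at *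
  field_simp

/-- In dimension two with one sampled coordinate, the two counts are swapped. -/
theorem swap_two {n : ℕ} (ω : Fin n → (Fin 1 ↪ Fin 2)) : Nc 1 ω = Mc 0 ω ∧ Mc 1 ω = Nc 0 ω := by
  have h : ∀ i, (1 : Fin 2) ∈ Set.range (ω i) ↔ ¬ (0 : Fin 2) ∈ Set.range (ω i) := by
    intro i
    simp only [Set.mem_range, Fin.exists_fin_one]
    generalize (ω i) 0 = a
    fin_cases a <;> simp
  constructor
  · unfold Nc Mc; simp only [h]
  · unfold Nc Mc; simp only [h, not_not]

theorem stmt_aux (p m nk : ℕ) (hm : 1 ≤ m) (hmp : m ≤ p) (hnk : 1 ≤ nk)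
    (t : ℝ) (ht : 0 ≤ t) :
    1 - p * Real.exp (-(nk * t ^ 2 / 2) /
        (((p : ℝ) / m - 1) + ((p : ℝ) / m + 1) * t / 3)) ≤
    probOf {ω : Fin nk → (Fin m ↪ Fin p) |
        specNorm (((p : ℝ) / m) • ((nk : ℝ)⁻¹ •
          ∑ i, sampMatrix (ω i) * (sampMatrix (ω i))ᵀ) - 1) ≤ t} := by
  have hne : Nonempty (Fin m ↪ Fin p) := ⟨Fin.castLEEmb hmp⟩
  have hM : 0 < Fintype.card (Fin m ↪ Fin p) := Fintype.card_pos
  have hp : 0 < p := by omega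
  have hnR : (0:ℝ) < nk := by exact_mod_cast hnk
  have hpR : (0:ℝ) < p := by exact_mod_cast hp
  have hmR : (0:ℝ) < m := by exact_mod_cast hm
  rcases hmp.eq_or_lt with heq | hlt
  · subst heq
    have key := prob_ge {ω : Fin nk → (Fin m ↪ Fin m) |
        specNorm (((m : ℝ) / m) • ((nk : ℝ)⁻¹ •
          ∑ i, sampMatrix (ω i) * (sampMatrix (ω i))ᵀ) - 1) ≤ t} ∅ (by
        intro ω _
        apply spec_le ω t _ ht
        intro j
        have hN : Nc j ω = nk := by
          unfold Nc
          rw [Finset.filter_true_of_mem]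
          · simp
          · intro i _
            exact Finite.surjective_of_injective (ω i).injective j
        rw [hN, div_self hmR.ne', inv_mul_cancel₀ hnR.ne']
        simpa using ht)
    simp only [Finset.card_empty, Nat.cast_zero, zero_div, sub_zero] at key
    refine le_trans ?_ key
    have : 0 ≤ (m:ℝ) * Real.exp (-(nk * t ^ 2 / 2) /
        (((m : ℝ) / m - 1) + ((m : ℝ) / m + 1) * t / 3)) := by positivity
    linarith
  · obtain ⟨q, hq⟩ : ∃ q : ℝ, q = (m:ℝ)/p := ⟨_, rfl⟩
    have hr : (p:ℝ)/m = q⁻¹ := by rw [hq, inv_div]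
    have hq0 : 0 < q := by rw [hq]; positivity
    have hq1 : q < 1 := by
      rw [hq, div_lt_one hpR]; exact_mod_cast hlt
    rw [hr, exponent_eq nk q t hnR hq0 hq1 ht]
    obtain ⟨x, hx⟩ : ∃ x : ℝ, x = nk*q*t := ⟨_, rfl⟩
    have hx0 : 0 ≤ x := by rw [hx]; positivity
    rw [← hx]
    by_cases hE : Real.log p ≤ x^2/(2*(nk*q*(1-q)+(1+q)/3*x))
    swap
    · have h0 : 0 ≤ probOf {ω : Fin nk → (Fin m ↪ Fin p) |
        specNorm (q⁻¹ • ((nk : ℝ)⁻¹ •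
          ∑ i, sampMatrix (ω i) * (sampMatrix (ω i))ᵀ) - 1) ≤ t} := by
        unfold probOf; positivity
      refine le_trans ?_ h0
      have h1 : Real.exp (-Real.log p) ≤ Real.exp (-(x^2/(2*(nk*q*(1-q)+(1+q)/3*x)))) :=
        Real.exp_le_exp.mpr (by linarith [not_le.mp hE])
      rw [Real.exp_neg, Real.exp_log hpR] at h1
      have h2 := mul_le_mul_of_nonneg_left h1 hpR.le
      rw [mul_inv_cancel₀ hpR.ne'] at h2
      linarith
    have good : ∀ (ω : Fin nk → (Fin m ↪ Fin p)), (∀ j, Nc j ω < ⌈nk*q+x⌉₊ ∧ Mc j ω < ⌈nk*(1-q)+x⌉₊) →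
        specNorm (q⁻¹ • ((nk : ℝ)⁻¹ •
          ∑ i, sampMatrix (ω i) * (sampMatrix (ω i))ᵀ) - 1) ≤ t := by
      intro ω h
      apply spec_le ω t _ ht
      intro j
      exact dev_cases nk (nk*q) x q t (Nc j ω) (Mc j ω) hnR hq0 (by exact_mod_cast Nc_add_Mc j ω) rfl hx (h j).1 (h j).2
    by_cases hp3 : 3 ≤ p
    · have key := prob_ge {ω : Fin nk → (Fin m ↪ Fin p) |
        specNorm (q⁻¹ • ((nk : ℝ)⁻¹ •
          ∑ i, sampMatrix (ω i) * (sampMatrix (ω i))ᵀ) - 1) ≤ t}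
          (Finset.univ.filter (fun ω : Fin nk → (Fin m ↪ Fin p) => ∃ j ∈ (Finset.univ : Finset (Fin p)), ⌈nk*q+x⌉₊ ≤ Nc j ω ∨ ⌈nk*(1-q)+x⌉₊ ≤ Mc j ω)) (by
          intro ω hω
          apply good ω
          intro j
          simp only [Finset.mem_filter, Finset.mem_univ, true_and] at hω
          push Not at hω
          exact hω j)
      have hb := bad_card (m := m) nk (Finset.univ : Finset (Fin p)) ⌈nk*q+x⌉₊ ⌈nk*(1-q)+x⌉₊ hp hM
      rw [← hq, Finset.card_univ, Fintype.card_fin] at hb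
      have hpb := pair_bound nk p m hnk hp3 hm hlt q x hq hx0 ⌈nk*q+x⌉₊ ⌈nk*(1-q)+x⌉₊ (Nat.le_ceil _) (Nat.le_ceil _) hE
      have := mul_le_mul_of_nonneg_left hpb hpR.le
      linarith
    · have hp2 : p = 2 := by omega
      have hm1 : m = 1 := by omega
      subst hp2 hm1
      have hqq : 1 - q = q := by rw [hq]; norm_num
      have key := prob_ge {ω : Fin nk → (Fin 1 ↪ Fin 2) |
        specNorm (q⁻¹ • ((nk : ℝ)⁻¹ •
          ∑ i, sampMatrix (ω i) * (sampMatrix (ω i))ᵀ) - 1) ≤ t}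
          (Finset.univ.filter (fun ω : Fin nk → (Fin 1 ↪ Fin 2) => ∃ j ∈ ({0} : Finset (Fin 2)), ⌈nk*q+x⌉₊ ≤ Nc j ω ∨ ⌈nk*(1-q)+x⌉₊ ≤ Mc j ω)) (by
          intro ω hω
          apply good ω
          simp only [Finset.mem_filter, Finset.mem_univ, true_and, Finset.mem_singleton, exists_eq_left] at hω
          push Not at hω
          have hs := swap_two ω
          rw [hqq] at hω ⊢
          intro j
          fin_cases j
          · exact hω
          · show Nc 1 ω < _ ∧ Mc 1 ω < _
            rw [hs.1, hs.2]; exact ⟨hω.2, hω.1⟩)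
      have hb := bad_card (m := 1) nk ({0} : Finset (Fin 2)) ⌈nk*q+x⌉₊ ⌈nk*(1-q)+x⌉₊ hp hM
      rw [← hq, Finset.card_singleton] at hb
      have b1 := bT_bern nk q ⌈nk*q+x⌉₊ x ((1+q)/3) hnk hq0 hq1 hx0 (Nat.le_ceil _) (by linarith)
      have b2 := bT_bern nk (1-q) ⌈nk*(1-q)+x⌉₊ x ((1+q)/3) hnk (by linarith) (by linarith) hx0 (Nat.le_ceil _) (by linarith)
      have e : (nk:ℝ)*(1-q)*(1-(1-q)) = nk*q*(1-q) := by ring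
      rw [e] at b2
      push_cast at hb ⊢
      linarith

end

/-- concentration of `H_k = (p/m)(1/n_k) Σᵢ Rᵢ Rᵢᵀ` around the identity:
`P(‖H_k − I_p‖₂ ≤ t) ≥ 1 − δ₃` with
`δ₃ = p·exp(−(n_k t²/2)/((p/m − 1) + (p/m + 1)·t/3))`. -/
theorem stmt_9 (p m nk : ℕ) (hm : 1 ≤ m) (hmp : m ≤ p) (hnk : 1 ≤ nk)
    (t : ℝ) (ht : 0 ≤ t) :
    probOf {ω : Fin nk → (Fin m ↪ Fin p) |
        specNorm (((p : ℝ) / m) • ((nk : ℝ)⁻¹ •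
          ∑ i, sampMatrix (ω i) * (sampMatrix (ω i))ᵀ) - 1) ≤ t} ≥
      1 - p * Real.exp (-(nk * t ^ 2 / 2) /
        (((p : ℝ) / m - 1) + ((p : ℝ) / m + 1) * t / 3)) := by
  exact stmt_aux p m nk hm hmp hnk t ht
end

section
/- Let 2 ≤ m ≤ p, let R ∈ ℝ^{p×m} be a sampling matrix whose m columns are chosen uniformly at random from the set of p canonical basis vectors of ℝ^p without replacement, and let x ∈ ℝ^p be a fixed vector. Then E[ R Rᵀ x xᵀ R Rᵀ ] = (m(m−1)/(p(p−1)))·x xᵀ + (m(p−m)/(p(p−1)))·diag(x xᵀ). -/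
open Matrix Finset

open Classical in
noncomputable def indA {p m : ℕ} (σ : Fin m ↪ Fin p) (i : Fin p) : ℝ :=
  if ∃ j, σ j = i then 1 else 0

lemma indA_eq_sum {p m : ℕ} (σ : Fin m ↪ Fin p) (i : Fin p) :
    indA σ i = ∑ j, if σ j = i then (1 : ℝ) else 0 := by
  unfold indA
  split_ifs with h
  · obtain ⟨j, rfl⟩ := h
    simp
  · push Not at h
    simp [h]

lemma indA_sq {p m : ℕ} (σ : Fin m ↪ Fin p) (i : Fin p) :
    indA σ i * indA σ i = indA σ i := by
  unfold indA
  split_ifs <;> simp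

lemma indA_sum {p m : ℕ} (σ : Fin m ↪ Fin p) : ∑ i, indA σ i = m := by
  simp_rw [indA_eq_sum]
  rw [Finset.sum_comm]
  simp

lemma samp_mul_s12 {p m : ℕ} (σ : Fin m ↪ Fin p) :
    sampMatrix σ * (sampMatrix σ)ᵀ = Matrix.diagonal (indA σ) := by
  ext i k
  rw [Matrix.mul_apply, Matrix.diagonal_apply]
  split_ifs with h
  · subst h
    rw [indA_eq_sum]
    refine Finset.sum_congr rfl fun j _ => ?_
    simp only [sampMatrix, Matrix.transpose_apply, Matrix.of_apply]
    split_ifs <;> simp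
  · apply Finset.sum_eq_zero
    intro j _
    simp only [sampMatrix, Matrix.transpose_apply, Matrix.of_apply]
    split_ifs with h1 h2
    · exact absurd (h1.symm.trans h2) h
    all_goals simp

lemma indA_perm {p m : ℕ} (σ : Fin m ↪ Fin p) (e : Equiv.Perm (Fin p)) (i : Fin p) :
    indA (σ.trans e.toEmbedding) (e i) = indA σ i := by
  simp [indA]

lemma sum_perm {p m : ℕ} (e : Equiv.Perm (Fin p)) (i j : Fin p) :
    ∑ σ : Fin m ↪ Fin p, indA σ (e i) * indA σ (e j)
      = ∑ σ : Fin m ↪ Fin p, indA σ i * indA σ j := by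
  symm
  refine Fintype.sum_equiv (Equiv.embeddingCongr (Equiv.refl _) e) _ _ ?_
  intro σ
  have h : Equiv.embeddingCongr (Equiv.refl _) e σ = σ.trans e.toEmbedding := by
    ext; simp
  rw [h, indA_perm, indA_perm]

lemma sum_diag {p m : ℕ} (i : Fin p) :
    (p : ℝ) * ∑ σ : Fin m ↪ Fin p, indA σ i * indA σ i
      = m * Fintype.card (Fin m ↪ Fin p) := by
  have h : ∀ k : Fin p, ∑ σ : Fin m ↪ Fin p, indA σ k * indA σ k
      = ∑ σ : Fin m ↪ Fin p, indA σ i * indA σ i := by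
    intro k
    have := sum_perm (m := m) (Equiv.swap i k) i i
    rwa [Equiv.swap_apply_left] at this
  have h2 : ∑ k : Fin p, ∑ σ : Fin m ↪ Fin p, indA σ k * indA σ k
      = m * Fintype.card (Fin m ↪ Fin p) := by
    rw [Finset.sum_comm]
    simp_rw [indA_sq, indA_sum]
    rw [Finset.sum_const, nsmul_eq_mul, Finset.card_univ, mul_comm]
  rw [← h2, Finset.sum_congr rfl (fun k _ => h k)]
  simp

lemma sum_offdiag {p m : ℕ} (i j : Fin p) (hij : i ≠ j) :
    ((p : ℝ) - 1) * ∑ σ : Fin m ↪ Fin p, indA σ i * indA σ j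
      = (m - 1) * ∑ σ : Fin m ↪ Fin p, indA σ i * indA σ i := by
  have h : ∀ k ∈ Finset.univ.erase i, ∑ σ : Fin m ↪ Fin p, indA σ i * indA σ k
      = ∑ σ : Fin m ↪ Fin p, indA σ i * indA σ j := by
    intro k hk
    have hk : k ≠ i := (Finset.mem_erase.1 hk).1
    have := sum_perm (m := m) (Equiv.swap j k) i j
    rwa [Equiv.swap_apply_left, Equiv.swap_apply_of_ne_of_ne hij hk.symm] at this
  have h2 : ∑ k : Fin p, ∑ σ : Fin m ↪ Fin p, indA σ i * indA σ k
      = m * ∑ σ : Fin m ↪ Fin p, indA σ i * indA σ i := by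
    rw [Finset.sum_comm]
    simp_rw [← Finset.mul_sum, indA_sum, indA_sq]
    rw [← Finset.sum_mul, mul_comm]
  rw [← Finset.add_sum_erase _ _ (Finset.mem_univ i), Finset.sum_congr rfl h,
    Finset.sum_const, Finset.card_erase_of_mem (Finset.mem_univ i), Finset.card_univ,
    Fintype.card_fin, nsmul_eq_mul, Nat.cast_sub (Fin.pos i), Nat.cast_one] at h2
  linarith

/-- `E[R Rᵀ x xᵀ R Rᵀ] = (m(m−1)/(p(p−1)))·x xᵀ + (m(p−m)/(p(p−1)))·diag(x xᵀ)`. -/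
theorem stmt_12 (p m : ℕ) (hm : 2 ≤ m) (hmp : m ≤ p) (x : Fin p → ℝ) :
    expec (fun σ : Fin m ↪ Fin p =>
        (sampMatrix σ * (sampMatrix σ)ᵀ) * Matrix.vecMulVec x x *
          (sampMatrix σ * (sampMatrix σ)ᵀ)) =
      (((m : ℝ) * ((m : ℝ) - 1)) / ((p : ℝ) * ((p : ℝ) - 1))) • Matrix.vecMulVec x x +
        (((m : ℝ) * ((p : ℝ) - m)) / ((p : ℝ) * ((p : ℝ) - 1))) •
          diagPart (Matrix.vecMulVec x x) := by
  have hp : (2 : ℝ) ≤ p := by exact_mod_cast hm.trans hmp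
  have hp0 : (p : ℝ) ≠ 0 := by linarith
  have hp1 : (p : ℝ) - 1 ≠ 0 := by linarith
  have hN : (Fintype.card (Fin m ↪ Fin p) : ℝ) ≠ 0 := by
    have : Nonempty (Fin m ↪ Fin p) := ⟨Fin.castLEEmb hmp⟩
    exact_mod_cast Fintype.card_ne_zero
  simp_rw [samp_mul_s12]
  ext i j
  have hL : (expec (fun σ : Fin m ↪ Fin p =>
        Matrix.diagonal (indA σ) * Matrix.vecMulVec x x * Matrix.diagonal (indA σ))) i j
      = (Fintype.card (Fin m ↪ Fin p) : ℝ)⁻¹ *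
        ((x i * x j) * ∑ σ : Fin m ↪ Fin p, indA σ i * indA σ j) := by
    unfold expec
    rw [Matrix.smul_apply, Matrix.sum_apply, smul_eq_mul, Finset.mul_sum _ _ (x i * x j)]
    congr 1
    refine Finset.sum_congr rfl fun σ _ => ?_
    rw [Matrix.mul_diagonal, Matrix.diagonal_mul, Matrix.vecMulVec_apply]
    ring
  rw [hL]
  have hd := sum_diag (m := m) i
  simp only [Matrix.add_apply, Matrix.smul_apply, diagPart, Matrix.diagonal_apply,
    Matrix.diag_apply, Matrix.vecMulVec_apply, smul_eq_mul]
  by_cases hij : i = j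
  · subst hij
    rw [if_pos rfl]
    have : ∑ σ : Fin m ↪ Fin p, indA σ i * indA σ i
        = m * Fintype.card (Fin m ↪ Fin p) / p := by
      rw [eq_div_iff hp0, ← hd, mul_comm]
    rw [this]
    field_simp
    ring
  · rw [if_neg hij]
    have ho := sum_offdiag (m := m) i j hij
    have : ∑ σ : Fin m ↪ Fin p, indA σ i * indA σ j
        = (m - 1) * (m * Fintype.card (Fin m ↪ Fin p)) / (p * (p - 1)) := by
      rw [eq_div_iff (mul_ne_zero hp0 hp1), ← hd]
      linear_combination (p : ℝ) * ho
    rw [this]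
    field_simp
    ring
end
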